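/- arXiv:0908.1749 — 2 statements merged into one kernel-verified Lean document; each statement's English description precedes it below -/
import Mathlib

section
/- Let e ≥ 2 and r ≥ 2 be integers. Suppose c ≤ d are integers and t_1,…,t_l ∈ {c, c+1, …, d}. Then in the l-wedge space Λ^l_{e,r}, the wedge |t_1⟩∧…∧|t_l⟩ lies in the ℚ(q)-span of the set of ordered wedges |u_1⟩∧…∧|u_l⟩ (with u_1 > … > u_l) satisfying u_1,…,u_l ∈ {c, c+1, …, d} and |{j ∈ {1,…,l} : u_j ∈ 𝟙_r}| = |{j ∈ {1,…,l} : t_j ∈ 𝟙_r}|. -/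
noncomputable section

/-- The field `ℚ(q)` of rational functions. -/
abbrev K : Type := RatFunc ℚ

/-- The element `q` of `ℚ(q)`. -/
def qK : K := RatFunc.X

/-- `a_{r'}(t)`: the unique element of `{1,…,e}` congruent to `t` modulo `e`
(this does not depend on `r'`). -/
def aFun (e t : ℤ) : ℤ := (t - 1) % e + 1

/-- `b_{r'}(t)`: the unique element of `{1,…,r'}` such that
`t = a_{r'}(t) + e (b_{r'}(t) − 1) − e r' m` for some integer `m`. -/
def bFun (e r t : ℤ) : ℤ := (t - 1) % (e * r) / e + 1

/-- `m_{r'}(t)`: the unique integer with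
`t = a_{r'}(t) + e (b_{r'}(t) − 1) − e r' m_{r'}(t)`. -/
def mFun (e r t : ℤ) : ℤ := (aFun e t + e * (bFun e r t - 1) - t) / (e * r)

/-- The free `ℚ(q)`-module on the set of `l`-tuples of integers
(the basis element at `(t₁,…,t_l)` is the formal wedge `|t₁⟩∧…∧|t_l⟩`). -/
abbrev FW (l : ℕ) := (Fin l → ℤ) →₀ K

/-- The formal two-entry wedge `|x⟩∧|y⟩` in the free module on pairs. -/
def pairTerm (x y : ℤ) : (ℤ × ℤ) →₀ K := Finsupp.single (x, y) 1

/-- The sum `Σ_{m ≥ m0} coeff m · |u−γ−Nm⟩∧|t+γ+Nm⟩`, where `m` ranges only over those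
values for which the displayed wedge is ordered (first entry strictly bigger).  Since
`N ≥ 2` and `γ ≥ 0` in all uses, all such `m` satisfy `m ≤ (u−t).toNat`, so the
following finite sum captures all of them. -/
def pairSum (N t u γ : ℤ) (m0 : ℕ) (coeff : ℕ → K) : (ℤ × ℤ) →₀ K :=
  ∑ m ∈ Finset.Ico m0 ((u - t).toNat + 1),
    if t + γ + N * m < u - γ - N * m then coeff m • pairTerm (u - γ - N * m) (t + γ + N * m)
    else 0

/-- For `t ≤ u`, the right-hand side of the straightening relation for `|t⟩∧|u⟩`
in the wedge space with parameters `e, r`. -/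
def pairRHS (e r t u : ℤ) : (ℤ × ℤ) →₀ K :=
  let N := e * r
  let α := (aFun e u - aFun e t) % N
  let β := (e * (bFun e r u - bFun e r t)) % N
  if α = 0 ∧ β = 0 then -pairTerm u t
  else if β = 0 then
    -(qK⁻¹ • pairTerm u t) +
      (qK ^ (-2 : ℤ) - 1) •
        (pairSum N t u α 0 (fun m => qK ^ (-2 * (m : ℤ))) -
          pairSum N t u 0 1 (fun m => qK ^ (1 - 2 * (m : ℤ))))
  else if α = 0 then
    -(qK • pairTerm u t) +
      (qK ^ (2 : ℤ) - 1) •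
        (pairSum N t u β 0 (fun m => qK ^ (2 * (m : ℤ))) -
          pairSum N t u 0 1 (fun m => qK ^ (2 * (m : ℤ) - 1)))
  else
    -pairTerm u t +
      (qK - qK⁻¹) • pairSum N t u β 0
        (fun m => (qK ^ (2 * (m : ℤ) + 1) + qK ^ (-2 * (m : ℤ) - 1)) / (qK + qK⁻¹)) +
      (qK⁻¹ - qK) • pairSum N t u α 0
        (fun m => (qK ^ (2 * (m : ℤ) + 1) + qK ^ (-2 * (m : ℤ) - 1)) / (qK + qK⁻¹)) +
      (qK - qK⁻¹) • pairSum N t u (α + β) 0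
        (fun m => (qK ^ (2 * (m : ℤ) + 2) - qK ^ (-2 * (m : ℤ) - 2)) / (qK + qK⁻¹)) +
      (qK⁻¹ - qK) • pairSum N t u 0 1
        (fun m => (qK ^ (2 * (m : ℤ)) - qK ^ (-2 * (m : ℤ))) / (qK + qK⁻¹))

/-- Replace the entries of an `l`-tuple at positions `j` and `j+1` by `p.1` and `p.2`. -/
def updPair (l : ℕ) (ts : Fin l → ℤ) (j : ℕ) (p : ℤ × ℤ) : Fin l → ℤ :=
  fun i => if (i : ℕ) = j then p.1 else if (i : ℕ) = j + 1 then p.2 else ts i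

/-- The set of straightening relators: for every `l`-tuple `ts` and every pair of
adjacent positions `j, j+1` with `ts j ≤ ts (j+1)`, the element
`|ts⟩ − (RHS of the straightening relation applied at positions j, j+1)`. -/
def relSet (e r : ℤ) (l : ℕ) : Set (FW l) :=
  {x | ∃ (ts : Fin l → ℤ) (j j' : Fin l), (j' : ℕ) = (j : ℕ) + 1 ∧ ts j ≤ ts j' ∧
      x = Finsupp.single ts 1 -
        (pairRHS e r (ts j) (ts j')).sum fun p c => Finsupp.single (updPair l ts (j : ℕ) p) c}

/-- The `l`-wedge space `Λ^l_{e,r}`: the quotient of the free module on `l`-tuples by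
the straightening relations. -/
abbrev WedgeSpace (e r : ℤ) (l : ℕ) := FW l ⧸ Submodule.span K (relSet e r l)

/-- The image of the wedge `|ts 0⟩∧…∧|ts (l−1)⟩` in the `l`-wedge space. -/
def wedge (e r : ℤ) (l : ℕ) (ts : Fin l → ℤ) : WedgeSpace e r l :=
  Submodule.Quotient.mk (Finsupp.single ts 1)

/-- The pairs `p` with `t ≤ p.2 < p.1` and `p.1 + p.2 = t + u` whose `b`-values are those of `t`
and `u` in some order. -/
def orderedPairs (e r t u : ℤ) : Set (ℤ × ℤ) :=
  {p | p.2 < p.1 ∧ t ≤ p.2 ∧ p.1 + p.2 = t + u ∧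
    ((bFun e r p.1 = bFun e r t ∧ bFun e r p.2 = bFun e r u) ∨
      (bFun e r p.1 = bFun e r u ∧ bFun e r p.2 = bFun e r t))}

theorem bFun_mul_add {e : ℤ} (r : ℤ) (q : ℤ) {a x : ℤ} (ha : 0 ≤ a) (hae : a < e)
    (hx : x - 1 = e * q + a) : bFun e r x = q % r + 1 := by
  have he : 0 < e := ha.trans_lt hae
  have hq : (e * q + a) / e = q := by
    rw [add_comm, Int.add_mul_ediv_left _ _ he.ne', Int.ediv_eq_zero_of_lt ha hae, zero_add]
  rw [bFun, hx, Int.emod_def, Int.sub_ediv_of_dvd _ ((dvd_mul_right e r).mul_right _),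
    mul_assoc, Int.mul_ediv_cancel_left _ he.ne', ← Int.ediv_ediv_of_nonneg he.le, hq,
    ← Int.emod_def]

theorem pairTerm_mem_supported {S : Set (ℤ × ℤ)} {x y : ℤ} (h : (x, y) ∈ S) :
    pairTerm x y ∈ Finsupp.supported K K S :=
  Finsupp.single_mem_supported K 1 h

theorem pairSum_mem_supported {e r N t u γ : ℤ} (hN : 0 ≤ N) (hγ : 0 ≤ γ)
    (h : ∀ m : ℤ,
      (bFun e r (u - γ - N * m) = bFun e r t ∧ bFun e r (t + γ + N * m) = bFun e r u) ∨
        (bFun e r (u - γ - N * m) = bFun e r u ∧ bFun e r (t + γ + N * m) = bFun e r t))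
    (m0 : ℕ) (coeff : ℕ → K) :
    pairSum N t u γ m0 coeff ∈ Finsupp.supported K K (orderedPairs e r t u) := by
  refine Submodule.sum_mem _ fun m _ => ?_
  split_ifs with hlt
  · refine Submodule.smul_mem _ _ (pairTerm_mem_supported ⟨hlt, ?_, by ring, h m⟩)
    have : 0 ≤ N * (m : ℤ) := by positivity
    change t ≤ t + γ + N * m
    linarith
  · exact Submodule.zero_mem _

theorem pairRHS_mem_supported {e r t u : ℤ} (he : 0 < e) (hr : 0 < r) (htu : t < u) :
    pairRHS e r t u ∈ Finsupp.supported K K (orderedPairs e r t u) := by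
  have hN : 0 < e * r := mul_pos he hr
  obtain ⟨qt, at', hat0, hat, htq⟩ : ∃ q a : ℤ, 0 ≤ a ∧ a < e ∧ t - 1 = e * q + a :=
    ⟨_, _, Int.emod_nonneg _ he.ne', Int.emod_lt_of_pos _ he, (Int.mul_ediv_add_emod _ e).symm⟩
  obtain ⟨qu, au', hau0, hau, huq⟩ : ∃ q a : ℤ, 0 ≤ a ∧ a < e ∧ u - 1 = e * q + a :=
    ⟨_, _, Int.emod_nonneg _ he.ne', Int.emod_lt_of_pos _ he, (Int.mul_ediv_add_emod _ e).symm⟩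
  have ht : bFun e r t = qt % r + 1 := bFun_mul_add r qt hat0 hat htq
  have hu : bFun e r u = qu % r + 1 := bFun_mul_add r qu hau0 hau huq
  have hmain : pairTerm u t ∈ Finsupp.supported K K (orderedPairs e r t u) :=
    pairTerm_mem_supported ⟨htu, le_rfl, add_comm _ _, Or.inr ⟨rfl, rfl⟩⟩
  set α := (aFun e u - aFun e t) % (e * r) with hα
  set β := (e * (bFun e r u - bFun e r t)) % (e * r) with hβ
  have hα0 : 0 ≤ α := Int.emod_nonneg _ hN.ne'
  have hβ0 : 0 ≤ β := Int.emod_nonneg _ hN.ne'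
  obtain ⟨k, hk⟩ : ∃ k, α = au' - at' + e * r * k := by
    refine ⟨-((aFun e u - aFun e t) / (e * r)), ?_⟩
    have h1 : aFun e u = au' + 1 := by
      rw [aFun, huq, add_comm (e * qu), Int.add_mul_emod_self_left, Int.emod_eq_of_lt hau0 hau]
    have h2 : aFun e t = at' + 1 := by
      rw [aFun, htq, add_comm (e * qt), Int.add_mul_emod_self_left, Int.emod_eq_of_lt hat0 hat]
    rw [hα, Int.emod_def, h1, h2]
    ring
  obtain ⟨k', hk'⟩ : ∃ k, β = e * (qu - qt) + e * r * k := by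
    refine ⟨qt / r - qu / r - (e * (bFun e r u - bFun e r t)) / (e * r), ?_⟩
    rw [hβ, Int.emod_def, hu, ht, Int.emod_def qu, Int.emod_def qt]
    ring
  have key : ∀ {x q q' : ℤ} (a n : ℤ), 0 ≤ a → a < e → x - 1 = e * (q' + r * n) + a →
      q' = q → bFun e r x = q % r + 1 := by
    intro x q q' a n h0 h1 h2 h3
    rw [bFun_mul_add r _ h0 h1 h2, Int.add_mul_emod_self_left, h3]
  have h0 := fun m0 c => pairSum_mem_supported (e := e) (r := r) (t := t) (u := u) hN.le le_rfl
    (fun m => Or.inr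
      ⟨by rw [hu]; exact key au' (-m) hau0 hau (by linear_combination huq) rfl,
        by rw [ht]; exact key at' m hat0 hat (by linear_combination htq) rfl⟩) m0 c
  have h1 := fun m0 c => pairSum_mem_supported (e := e) (r := r) (t := t) (u := u) hN.le hα0
    (fun m => Or.inr
      ⟨by rw [hu]; exact key at' (-k - m) hat0 hat (by linear_combination huq - hk) rfl,
        by rw [ht]; exact key au' (k + m) hau0 hau (by linear_combination htq + hk) rfl⟩) m0 c
  have h2 := fun m0 c => pairSum_mem_supported (e := e) (r := r) (t := t) (u := u) hN.le hβ0
    (fun m => Or.inl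
      ⟨by rw [ht]; exact key au' (-k' - m) hau0 hau (by linear_combination huq - hk') rfl,
        by rw [hu]; exact key at' (k' + m) hat0 hat (by linear_combination htq + hk') rfl⟩) m0 c
  have h3 := fun m0 c => pairSum_mem_supported (e := e) (r := r) (t := t) (u := u) hN.le
    (add_nonneg hα0 hβ0)
    (fun m => Or.inl
      ⟨by
        rw [ht]
        exact key at' (-k - k' - m) hat0 hat (by linear_combination huq - hk - hk') rfl,
      by
        rw [hu]
        exact key au' (k + k' + m) hau0 hau (by linear_combination htq + hk + hk') rfl⟩) m0 c
  unfold pairRHS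
  simp only [← hα, ← hβ]
  split_ifs
  · exact neg_mem hmain
  · exact add_mem (neg_mem (Submodule.smul_mem _ _ hmain))
      (Submodule.smul_mem _ _ (sub_mem (h1 _ _) (h0 _ _)))
  · exact add_mem (neg_mem (Submodule.smul_mem _ _ hmain))
      (Submodule.smul_mem _ _ (sub_mem (h2 _ _) (h0 _ _)))
  · exact add_mem (add_mem (add_mem (add_mem (neg_mem hmain) (Submodule.smul_mem _ _ (h2 _ _)))
      (Submodule.smul_mem _ _ (h1 _ _))) (Submodule.smul_mem _ _ (h3 _ _)))
      (Submodule.smul_mem _ _ (h0 _ _))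

theorem pairRHS_self (e r t : ℤ) : pairRHS e r t t = -pairTerm t t := by
  simp [pairRHS]

theorem updPair_left {l : ℕ} (ts : Fin l → ℤ) (j : Fin l) (p : ℤ × ℤ) :
    updPair l ts j p j = p.1 := by
  simp [updPair]

theorem updPair_right {l : ℕ} (ts : Fin l → ℤ) {j j' : Fin l} (hj : (j' : ℕ) = j + 1)
    (p : ℤ × ℤ) : updPair l ts j p j' = p.2 := by
  simp [updPair, hj]

theorem updPair_of_ne {l : ℕ} (ts : Fin l → ℤ) {i j j' : Fin l} (hj : (j' : ℕ) = j + 1)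
    (p : ℤ × ℤ) (h : i ≠ j) (h' : i ≠ j') : updPair l ts j p i = ts i := by
  rw [Ne, Fin.ext_iff] at h h'
  rw [updPair, if_neg h, if_neg (hj ▸ h')]

theorem updPair_self {l : ℕ} (ts : Fin l → ℤ) {j j' : Fin l} (hj : (j' : ℕ) = j + 1) :
    updPair l ts j (ts j, ts j') = ts := by
  funext i
  by_cases h : i = j
  · rw [h, updPair_left]
  by_cases h' : i = j'
  · rw [h', updPair_right ts hj]
  exact updPair_of_ne ts hj _ h h'

/-- The straightening relation in the wedge space. -/
theorem wedge_eq_sum {e r : ℤ} {l : ℕ} (ts : Fin l → ℤ) {j j' : Fin l} (hj : (j' : ℕ) = j + 1)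
    (h : ts j ≤ ts j') :
    wedge e r l ts =
      (pairRHS e r (ts j) (ts j')).sum fun p c => c • wedge e r l (updPair l ts j p) := by
  have hrel := (Submodule.Quotient.eq _).2
    (Submodule.subset_span (R := K) (s := relSet e r l) ⟨ts, j, j', hj, h, rfl⟩)
  refine hrel.trans ?_
  rw [← Submodule.mkQ_apply, Finsupp.sum, map_sum]
  refine Finset.sum_congr rfl fun p _ => ?_
  rw [← Finsupp.smul_single_one, map_smul]
  rfl

theorem wedge_eq_zero {e r : ℤ} {l : ℕ} (ts : Fin l → ℤ) {j j' : Fin l}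
    (hj : (j' : ℕ) = j + 1) (h : ts j = ts j') : wedge e r l ts = 0 := by
  have h1 := wedge_eq_sum (e := e) (r := r) ts hj h.le
  rw [← h, pairRHS_self, pairTerm, ← Finsupp.single_neg,
    Finsupp.sum_single_index (by rw [zero_smul]),
    neg_one_smul] at h1
  nth_rewrite 2 [h] at h1
  rw [updPair_self ts hj] at h1
  have h2 : (2 : K) • wedge e r l ts = 0 := by
    rw [two_smul]
    nth_rewrite 1 [h1]
    exact neg_add_cancel _
  exact (smul_eq_zero.1 h2).resolve_left two_ne_zero

theorem card_filter_updPair {e r : ℤ} {l : ℕ} (ts : Fin l → ℤ) {j j' : Fin l}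
    (hj : (j' : ℕ) = j + 1) {p : ℤ × ℤ} (hp : p ∈ orderedPairs e r (ts j) (ts j')) :
    (Finset.univ.filter fun i => bFun e r (updPair l ts j p i) = 1).card =
      (Finset.univ.filter fun i => bFun e r (ts i) = 1).card := by
  obtain ⟨σ, hσ⟩ : ∃ σ : Equiv.Perm (Fin l), ∀ i,
      bFun e r (updPair l ts j p i) = bFun e r (ts (σ i)) := by
    rcases hp.2.2.2 with ⟨h1, h2⟩ | ⟨h1, h2⟩
    · refine ⟨Equiv.refl _, fun i => ?_⟩
      rw [Equiv.refl_apply]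
      by_cases h : i = j
      · rw [h, updPair_left, h1]
      by_cases h' : i = j'
      · rw [h', updPair_right ts hj, h2]
      rw [updPair_of_ne ts hj _ h h']
    · refine ⟨Equiv.swap j j', fun i => ?_⟩
      by_cases h : i = j
      · rw [h, updPair_left, h1, Equiv.swap_apply_left]
      by_cases h' : i = j'
      · rw [h', updPair_right ts hj, h2, Equiv.swap_apply_right]
      rw [updPair_of_ne ts hj _ h h', Equiv.swap_apply_of_ne_of_ne h h']
  exact Finset.card_equiv σ fun i => by simp [hσ]

theorem sum_mul_updPair_lt {e r : ℤ} {l : ℕ} (c : ℤ) (ts : Fin l → ℤ) {j j' : Fin l}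
    (hj : (j' : ℕ) = j + 1) {p : ℤ × ℤ} (hp : p ∈ orderedPairs e r (ts j) (ts j')) :
    ∑ i : Fin l, (i : ℤ) * (updPair l ts j p i - c) < ∑ i : Fin l, (i : ℤ) * (ts i - c) := by
  have hne : j ≠ j' := fun h => by simp [h] at hj
  have hdiff : ∀ i : Fin l, (i : ℤ) * (updPair l ts j p i - c) - (i : ℤ) * (ts i - c) =
      (if i = j then (j : ℤ) * (p.1 - ts j) else 0) +
        (if i = j' then (j' : ℤ) * (p.2 - ts j') else 0) := by
    intro i
    by_cases h : i = j
    · subst h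
      rw [updPair_left, if_pos rfl, if_neg hne]
      ring
    by_cases h' : i = j'
    · subst h'
      rw [updPair_right ts hj, if_pos rfl, if_neg h]
      ring
    rw [updPair_of_ne ts hj _ h h', if_neg h, if_neg h']
    ring
  obtain ⟨hlt, hle, hsum, -⟩ := hp
  have hj' : (j' : ℤ) = j + 1 := by exact_mod_cast hj
  rw [← sub_neg, ← Finset.sum_sub_distrib, Finset.sum_congr rfl fun i _ => hdiff i,
    Finset.sum_add_distrib, Finset.sum_ite_eq' _ j, Finset.sum_ite_eq' _ j',
    if_pos (Finset.mem_univ _), if_pos (Finset.mem_univ _), hj']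
  have : (j : ℤ) * (p.1 - ts j) + ((j : ℤ) + 1) * (p.2 - ts j') = p.2 - ts j' := by
    linear_combination (j : ℤ) * hsum
  linarith

theorem updPair_mem_Icc {e r c d : ℤ} {l : ℕ} {ts : Fin l → ℤ} (hts : ∀ i, ts i ∈ Set.Icc c d)
    {j j' : Fin l} (hj : (j' : ℕ) = j + 1) {p : ℤ × ℤ}
    (hp : p ∈ orderedPairs e r (ts j) (ts j')) (i : Fin l) :
    updPair l ts j p i ∈ Set.Icc c d := by
  obtain ⟨hlt, hle, hsum, -⟩ := hp
  have h1 := (hts j).1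
  have h2 := (hts j').2
  by_cases h : i = j
  · rw [h, updPair_left]
    constructor <;> linarith
  by_cases h' : i = j'
  · rw [h', updPair_right ts hj]
    constructor <;> linarith
  rw [updPair_of_ne ts hj _ h h']
  exact hts i

theorem exists_le_of_not_strictAnti {l : ℕ} {ts : Fin l → ℤ} (h : ¬StrictAnti ts) :
    ∃ j j' : Fin l, (j' : ℕ) = j + 1 ∧ ts j ≤ ts j' := by
  cases l with
  | zero => exact absurd (fun i => i.elim0) h
  | succ n =>
    rw [Fin.strictAnti_iff_succ_lt] at h
    push Not at h
    obtain ⟨i, hi⟩ := h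
    exact ⟨i.castSucc, i.succ, by simp, hi⟩

/-- For `e ≥ 2`, `r ≥ 2`, `c ≤ d` and `t₁,…,t_l ∈ {c,…,d}`, the wedge
`|t₁⟩∧…∧|t_l⟩` lies in the span of the ordered wedges `|u₁⟩∧…∧|u_l⟩` with all entries in
`{c,…,d}` and with the same number of entries lying in `𝟙_r`. -/
theorem wedge_mem_span_ordered (e r : ℤ) (he : 2 ≤ e) (hr : 2 ≤ r)
    (c d : ℤ) (hcd : c ≤ d) (l : ℕ) (ts : Fin l → ℤ) (hts : ∀ j, ts j ∈ Set.Icc c d) :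
    wedge e r l ts ∈ Submodule.span K
      {w : WedgeSpace e r l | ∃ us : Fin l → ℤ, StrictAnti us ∧
        (∀ j, us j ∈ Set.Icc c d) ∧
        (Finset.univ.filter fun j => bFun e r (us j) = 1).card =
          (Finset.univ.filter fun j => bFun e r (ts j) = 1).card ∧
        w = wedge e r l us} := by
  induction hn : (∑ i : Fin l, (i : ℤ) * (ts i - c)).toNat using Nat.strong_induction_on
    generalizing ts with
  | _ n ih =>
    by_cases hanti : StrictAnti ts
    · exact Submodule.subset_span ⟨ts, hanti, hts, rfl, rfl⟩
    obtain ⟨j, j', hj, hle⟩ := exists_le_of_not_strictAnti hanti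
    rcases hle.eq_or_lt with heq | hlt
    · rw [wedge_eq_zero ts hj heq]
      exact Submodule.zero_mem _
    rw [wedge_eq_sum ts hj hle]
    refine Submodule.sum_mem _ fun p hp => Submodule.smul_mem _ _ ?_
    have hp' : p ∈ orderedPairs e r (ts j) (ts j') :=
      (Finsupp.mem_supported K _).1 (pairRHS_mem_supported (by lia) (by lia) hlt) hp
    have hmem := updPair_mem_Icc hts hj hp'
    have hnonneg : 0 ≤ ∑ i : Fin l, (i : ℤ) * (updPair l ts j p i - c) :=
      Finset.sum_nonneg fun i _ => mul_nonneg (by positivity) (sub_nonneg.2 (hmem i).1)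
    have := ih _ (by have := sum_mul_updPair_lt c ts hj hp'; lia) _ hmem rfl
    rwa [card_filter_updPair ts hj hp'] at this

end
end

section
/- Let e ≥ 2 and r ≥ 2 be integers and let c be an integer. Suppose v_1, v_2, w_1, w_2 are integers, each ≥ c and each lying outside 𝟙_r, satisfying: w_1 + w_2 = v_1 + v_2; the multiset {a_r(w_1), a_r(w_2)} equals the multiset {a_r(v_1), a_r(v_2)}; and the multiset {b_r(w_1), b_r(w_2)} equals the multiset {b_r(v_1), b_r(v_2)}. Then X_c(w_1) + X_c(w_2) = X_c(v_1) + X_c(v_2) and Y_c(w_1) + Y_c(w_2) = Y_c(v_1) + Y_c(v_2). -/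
noncomputable section

/-- `X_c(v) = |{c, …, v} ∩ 𝟙_r|`. -/
def Xc (e r c v : ℤ) : ℕ := ((Finset.Icc c v).filter fun t => bFun e r t = 1).card

/-- `Y_c(v) = |{c, …, v} ∩ 𝟙_r ∩ (v + eℤ)}|`. -/
def Yc (e r c v : ℤ) : ℕ :=
  ((Finset.Icc c v).filter fun t => bFun e r t = 1 ∧ t % e = v % e).card

theorem aFun_mem_Icc {e : ℤ} (he : 0 < e) (t : ℤ) : aFun e t ∈ Finset.Icc 1 e := by
  have h₁ := Int.emod_nonneg (t - 1) he.ne'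
  have h₂ := Int.emod_lt_of_pos (t - 1) he
  rw [Finset.mem_Icc, aFun]
  omega

theorem aFun_eq_aFun_iff (e s t : ℤ) : aFun e s = aFun e t ↔ s % e = t % e := by
  rw [aFun, aFun, add_left_inj]
  exact ⟨fun h => by simpa [Int.ModEq] using Int.ModEq.add_right 1 h, fun h => Int.ModEq.sub_right 1 h⟩

theorem bFun_eq_one_iff {e r : ℤ} (he : 0 < e) (hr : 0 < r) (t : ℤ) :
    bFun e r t = 1 ↔ (t - 1) % (e * r) < e := by
  have h := Int.emod_nonneg (t - 1) (mul_pos he hr).ne'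
  rw [bFun, add_eq_right, Int.ediv_eq_iff_of_pos he]
  simp [h]

theorem aFun_add_bFun_add_ediv (e r t : ℤ) :
    aFun e t + e * (bFun e r t - 1) + e * r * ((t - 1) / (e * r)) = t := by
  have h₁ := Int.mul_ediv_add_emod ((t - 1) % (e * r)) e
  have h₂ := Int.mul_ediv_add_emod (t - 1) (e * r)
  rw [Int.emod_emod_of_dvd _ (dvd_mul_right e r)] at h₁
  rw [aFun, bFun]
  linarith

theorem bFun_eq_one_and_aFun_eq_iff {e r a : ℤ} (he : 0 < e) (hr : 0 < r)
    (ha : a ∈ Finset.Icc 1 e) (t : ℤ) :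
    bFun e r t = 1 ∧ aFun e t = a ↔ ∃ k, a + e * r * k = t := by
  constructor
  · rintro ⟨hb, rfl⟩
    refine ⟨(t - 1) / (e * r), ?_⟩
    simpa [hb] using aFun_add_bFun_add_ediv e r t
  · rintro ⟨k, rfl⟩
    rw [Finset.mem_Icc] at ha
    have hmod : (a + e * r * k - 1) % (e * r) = a - 1 := by
      rw [add_sub_right_comm, Int.add_mul_emod_self_left]
      exact Int.emod_eq_of_lt (by linarith) (by nlinarith)
    rw [bFun_eq_one_iff he hr, hmod, aFun,
      ← Int.emod_emod_of_dvd _ (dvd_mul_right e r), hmod,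
      Int.emod_eq_of_lt (by linarith) (by linarith)]
    constructor <;> linarith

/-- The number of elements of `{c, …, v} ∩ 𝟙_r` in a given residue class modulo `e`,
when `v` lies outside `𝟙_r`. -/
theorem card_filter_bFun_eq_one_and_aFun_eq {e r c v a : ℤ} (he : 0 < e) (hr : 0 < r)
    (hcv : c ≤ v) (hv : bFun e r v ≠ 1) (ha : a ∈ Finset.Icc 1 e) :
    (((Finset.Icc c v).filter fun t => bFun e r t = 1 ∧ aFun e t = a).card : ℤ) =
      (v - 1) / (e * r) + 1 + (a - c) / (e * r) := by
  have hN : 0 < e * r := mul_pos he hr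
  have ha' := Finset.mem_Icc.1 ha
  have hve : e ≤ (v - 1) % (e * r) := by
    rwa [ne_eq, bFun_eq_one_iff he hr, not_lt] at hv
  have hdiv := Int.mul_ediv_add_emod (v - 1) (e * r)
  have hlt := Int.emod_lt_of_pos (v - 1) hN
  have himage : ((Finset.Icc c v).filter fun t => bFun e r t = 1 ∧ aFun e t = a) =
      (Finset.Icc (-((a - c) / (e * r))) ((v - 1) / (e * r))).image
        fun k => a + e * r * k := by
    ext t
    simp only [Finset.mem_filter, Finset.mem_image, bFun_eq_one_and_aFun_eq_iff he hr ha]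
    have key : ∀ k, a + e * r * k ∈ Finset.Icc c v ↔
        k ∈ Finset.Icc (-((a - c) / (e * r))) ((v - 1) / (e * r)) := by
      intro k
      rw [Finset.mem_Icc, Finset.mem_Icc, neg_le, Int.le_ediv_iff_mul_le hN]
      refine and_congr ⟨fun h => by linarith, fun h => by linarith⟩ ⟨fun h => ?_, fun h => ?_⟩
      · rw [Int.le_ediv_iff_mul_le hN]
        linarith
      · have := mul_le_mul_of_nonneg_left h hN.le
        linarith
    constructor
    · rintro ⟨h, k, rfl⟩
      exact ⟨k, (key k).1 h, rfl⟩
    · rintro ⟨k, h, rfl⟩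
      exact ⟨(key k).2 h, k, rfl⟩
  have hinj : Function.Injective fun k : ℤ => a + e * r * k := fun k l h =>
    mul_left_cancel₀ hN.ne' (add_left_cancel h)
  have hnonneg : -((v - 1) / (e * r) + 1) ≤ (a - c) / (e * r) := by
    rw [Int.le_ediv_iff_mul_le hN]
    linarith
  rw [himage, Finset.card_image_of_injective _ hinj, Int.card_Icc,
    Int.toNat_of_nonneg (by linarith)]
  ring

theorem Xc_eq {e r c v : ℤ} (he : 0 < e) (hr : 0 < r) (hcv : c ≤ v) (hv : bFun e r v ≠ 1) :
    (Xc e r c v : ℤ) =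
      e * ((v - 1) / (e * r)) + ∑ a ∈ Finset.Icc 1 e, (1 + (a - c) / (e * r)) := by
  rw [Xc, Finset.card_eq_sum_card_fiberwise (f := aFun e) (t := Finset.Icc 1 e)
    fun t _ => aFun_mem_Icc he t]
  push_cast
  simp only [Finset.filter_filter]
  rw [Finset.sum_congr rfl fun a ha => card_filter_bFun_eq_one_and_aFun_eq he hr hcv hv ha]
  simp only [add_assoc]
  rw [Finset.sum_add_distrib, Finset.sum_const, Int.card_Icc, nsmul_eq_mul,
    Int.toNat_of_nonneg (by linarith), add_sub_cancel_right]

theorem Yc_eq {e r c v : ℤ} (he : 0 < e) (hr : 0 < r) (hcv : c ≤ v) (hv : bFun e r v ≠ 1) :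
    (Yc e r c v : ℤ) = (v - 1) / (e * r) + 1 + (aFun e v - c) / (e * r) := by
  rw [← card_filter_bFun_eq_one_and_aFun_eq he hr hcv hv (aFun_mem_Icc he v), Yc]
  simp only [aFun_eq_aFun_iff]

theorem apply_add_apply_of_pair_eq {α M : Type*} [AddCommMonoid M] {a b c d : α}
    (h : ({a, b} : Multiset α) = {c, d}) (f : α → M) : f a + f b = f c + f d := by
  simpa using congrArg (fun s => (s.map f).sum) h

/-- Suppose `v₁, v₂, w₁, w₂ ≥ c` all lie outside `𝟙_r`,
`w₁ + w₂ = v₁ + v₂`, and the multisets `{a_r(w₁), a_r(w₂)}` and `{b_r(w₁), b_r(w₂)}`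
agree with `{a_r(v₁), a_r(v₂)}` and `{b_r(v₁), b_r(v₂)}` respectively.  Then
`X_c(w₁) + X_c(w₂) = X_c(v₁) + X_c(v₂)` and `Y_c(w₁) + Y_c(w₂) = Y_c(v₁) + Y_c(v₂)`. -/
theorem XY_sum_invariant (e r : ℤ) (he : 2 ≤ e) (hr : 2 ≤ r) (c : ℤ)
    (v₁ v₂ w₁ w₂ : ℤ)
    (hv₁ : c ≤ v₁) (hv₂ : c ≤ v₂) (hw₁ : c ≤ w₁) (hw₂ : c ≤ w₂)
    (hv₁' : bFun e r v₁ ≠ 1) (hv₂' : bFun e r v₂ ≠ 1)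
    (hw₁' : bFun e r w₁ ≠ 1) (hw₂' : bFun e r w₂ ≠ 1)
    (hsum : w₁ + w₂ = v₁ + v₂)
    (ha : ({aFun e w₁, aFun e w₂} : Multiset ℤ) = {aFun e v₁, aFun e v₂})
    (hb : ({bFun e r w₁, bFun e r w₂} : Multiset ℤ) = {bFun e r v₁, bFun e r v₂}) :
    Xc e r c w₁ + Xc e r c w₂ = Xc e r c v₁ + Xc e r c v₂ ∧
      Yc e r c w₁ + Yc e r c w₂ = Yc e r c v₁ + Yc e r c v₂ := by
  have he₀ : 0 < e := by linarith
  have hr₀ : 0 < r := by linarith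
  have hN : 0 < e * r := mul_pos he₀ hr₀
  have hdiv : (w₁ - 1) / (e * r) + (w₂ - 1) / (e * r) =
      (v₁ - 1) / (e * r) + (v₂ - 1) / (e * r) := by
    apply mul_left_cancel₀ hN.ne'
    have hasum := apply_add_apply_of_pair_eq ha id
    have hbsum := apply_add_apply_of_pair_eq hb (e * ·)
    simp only [id] at hasum hbsum
    linarith [aFun_add_bFun_add_ediv e r w₁, aFun_add_bFun_add_ediv e r w₂,
      aFun_add_bFun_add_ediv e r v₁, aFun_add_bFun_add_ediv e r v₂]
  constructor <;> zify
  · rw [Xc_eq he₀ hr₀ hw₁ hw₁', Xc_eq he₀ hr₀ hw₂ hw₂', Xc_eq he₀ hr₀ hv₁ hv₁',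
      Xc_eq he₀ hr₀ hv₂ hv₂']
    linear_combination e * hdiv
  · rw [Yc_eq he₀ hr₀ hw₁ hw₁', Yc_eq he₀ hr₀ hw₂ hw₂', Yc_eq he₀ hr₀ hv₁ hv₁',
      Yc_eq he₀ hr₀ hv₂ hv₂']
    linear_combination hdiv + apply_add_apply_of_pair_eq ha fun a => (a - c) / (e * r)

end
end
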